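/- Fix ε > 0, δ ∈ (0,1), a positive integer k, and a natural number λ with λ ≥ 20·((e^ε+1)/(e^ε-1))²·ln(2/δ). Consider the online histogram algorithm on streams x ∈ [k]^n that runs, independently for each j ∈ [k], a copy of Q_ZSUM on the indicator stream (1{x_1 = j}, …, 1{x_n = j}): each copy initializes its counter with an independent draw from Binomial(λ, 1/2), increments it by the indicator at each step, adds an independent Binomial(λ, 1/2) draw to it at the end, and the algorithm outputs the vector of the k resulting noisy counts. This algorithm is (2ε, 2δ)-pan-private with respect to streams in [k]^n (neighboring streams differ in one element), and for every stream x its output (c̃_1, …, c̃_k) satisfies max_{j ∈ [k]} |c̃_j - c_j(x)| ≤ 2λ, where c_j(x) is the number of occurrences of j in x. -/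

import Mathlib

open scoped ENNReal

/-- `Binomial(λ, 1/2)` as a distribution on `ℕ`. -/
noncomputable def binomHalf (l : ℕ) : PMF ℕ :=
  (PMF.binomial (1 / 2) (by simp [ENNReal.div_le_iff]) l).map Fin.val

/-- Product of finitely many distributions on `ℕ` (independent coordinates). -/
noncomputable def pmfPi : {k : ℕ} → (Fin k → PMF ℕ) → PMF (Fin k → ℕ)
  | 0, _ => PMF.pure finZeroElim
  | _ + 1, q => (q 0).bind fun a => (pmfPi fun j => q j.succ).map (Fin.cons a)

/-- Streams differing in at most one element. -/
def Neighbor {α : Type*} {n : ℕ} (x x' : Fin n → α) : Prop :=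
  ∃ i, ∀ j, j ≠ i → x j = x' j

/-- Number of occurrences of `j` among the first `t` elements of the stream. -/
noncomputable def cnt {k n : ℕ} (x : Fin n → Fin k) (j : Fin k) (t : ℕ) : ℕ :=
  (Finset.univ.filter fun i : Fin n => (i : ℕ) < t ∧ x i = j).card

/-- Joint distribution of (internal state at time `t`, final output) of the
pan-private histogram algorithm: one copy of `Q_ZSUM` per domain element `j`,
i.e. counter `j` is initialized with an independent `Binomial(λ,1/2)` draw,
incremented by the indicator `1{xᵢ = j}` at each step, and an independent
`Binomial(λ,1/2)` draw is added at the end; the output is the vector of the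
`k` noisy counts. -/
noncomputable def histJoint (lam k n : ℕ) (x : Fin n → Fin k) (t : ℕ) :
    PMF ((Fin k → ℕ) × (Fin k → ℕ)) :=
  (pmfPi fun _ => binomHalf lam).bind fun a =>
    (pmfPi fun _ => binomHalf lam).map fun b =>
      (fun j => a j + cnt x j t, fun j => a j + cnt x j n + b j)

namespace PMF

variable {α β γ : Type*}

/-- Approximate domination of push-forwards: off a set `B` of mass at most `d`, the map `σ` loses at
most a factor `c` of mass and intertwines `f` with `f'`. -/
lemma toOuterMeasure_map_le_of_shift (μ : PMF α) {f f' : α → β} (hf : Function.Injective f)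
    (σ : α → α) {B : Set α} {c d : ℝ≥0∞} (hB : μ.toOuterMeasure B ≤ d)
    (hσ : ∀ a ∉ B, μ a ≤ c * μ (σ a) ∧ f' (σ a) = f a) (T : Set β) :
    (μ.map f).toOuterMeasure T ≤ c * (μ.map f').toOuterMeasure T + d := by
  classical
  rw [toOuterMeasure_map_apply, toOuterMeasure_map_apply]
  have hcover : μ.toOuterMeasure (f ⁻¹' T) ≤
      μ.toOuterMeasure ((f ⁻¹' T) \ B) + μ.toOuterMeasure B :=
    (MeasureTheory.measure_mono (by intro a; by_cases a ∈ B <;> simp_all)).trans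
      (MeasureTheory.measure_union_le _ _)
  refine hcover.trans (add_le_add ?_ hB)
  set S : Set α := (f ⁻¹' T) \ B with hS
  have hinj : Function.Injective fun a : S => σ a := by
    intro a b hab
    apply Subtype.ext
    apply hf
    rw [← (hσ a a.2.2).2, ← (hσ b b.2.2).2]
    exact congrArg f' hab
  calc μ.toOuterMeasure S = ∑' a : S, μ a := by
        rw [toOuterMeasure_apply, tsum_subtype]
    _ ≤ ∑' a : S, c * (f' ⁻¹' T).indicator μ (σ a) := by
        refine ENNReal.tsum_le_tsum fun a => ?_
        have h := hσ a a.2.2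
        have hmem : σ a ∈ f' ⁻¹' T := by
          rw [Set.mem_preimage, h.2]
          exact a.2.1
        rw [Set.indicator_of_mem hmem]
        exact h.1
    _ = c * ∑' a : S, (f' ⁻¹' T).indicator μ (σ a) := ENNReal.tsum_mul_left
    _ ≤ c * μ.toOuterMeasure (f' ⁻¹' T) := by
        rw [toOuterMeasure_apply]
        gcongr
        exact ENNReal.tsum_comp_le_tsum_of_injective hinj _

lemma toOuterMeasure_bind_le (μ : PMF α) {f g : α → PMF β} {c d : ℝ≥0∞} {T : Set β}
    (h : ∀ a, (f a).toOuterMeasure T ≤ c * (g a).toOuterMeasure T + d) :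
    (μ.bind f).toOuterMeasure T ≤ c * (μ.bind g).toOuterMeasure T + d := by
  rw [toOuterMeasure_bind_apply, toOuterMeasure_bind_apply]
  calc ∑' a, μ a * (f a).toOuterMeasure T
      ≤ ∑' a, (c * (μ a * (g a).toOuterMeasure T) + μ a * d) := by
        refine ENNReal.tsum_le_tsum fun a => ?_
        calc μ a * (f a).toOuterMeasure T ≤ μ a * (c * (g a).toOuterMeasure T + d) := by
              gcongr
              exact h a
          _ = _ := by ring
    _ = _ := by
        rw [ENNReal.tsum_add, ENNReal.tsum_mul_left, ENNReal.tsum_mul_right, tsum_coe, one_mul]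

lemma bind_map_comm (p : PMF α) (q : PMF β) (f : α → β → γ) :
    (p.bind fun a => q.map (f a)) = q.bind fun b => p.map fun a => f a b :=
  bind_comm p q fun a b => pure (f a b)

end PMF

lemma pmfPi_apply {k : ℕ} (q : Fin k → PMF ℕ) (a : Fin k → ℕ) :
    pmfPi q a = ∏ j, q j (a j) := by
  classical
  induction k with
  | zero => simp [pmfPi, Subsingleton.elim a finZeroElim]
  | succ k ih =>
    have hcons : ∀ (m : ℕ) (b : Fin k → ℕ),
        a = @Fin.cons k (fun _ => ℕ) m b ↔ b = (fun j => a j.succ) ∧ m = a 0 := by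
      intro m b
      simp only [funext_iff, Fin.forall_fin_succ, Fin.cons_zero, Fin.cons_succ, eq_comm, and_comm]
    have hmap : ∀ m : ℕ, ((pmfPi fun j => q j.succ).map (@Fin.cons k (fun _ => ℕ) m)) a =
        if m = a 0 then ∏ j : Fin k, q j.succ (a j.succ) else 0 := by
      intro m
      simp only [PMF.map_apply, hcons]
      rw [tsum_eq_single fun j => a j.succ]
      · simp [ih]
      · intro b hb
        simp [hb]
    rw [pmfPi, PMF.bind_apply, Fin.prod_univ_succ]
    simp only [hmap]
    rw [tsum_eq_single (a 0)]
    · simp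
    · intro m hm
      simp [hm]

lemma pmfPi_map_eval {k : ℕ} (q : Fin k → PMF ℕ) (p : Fin k) :
    (pmfPi q).map (fun a => a p) = q p := by
  induction k with
  | zero => exact p.elim0
  | succ k ih =>
    rw [pmfPi, PMF.map_bind]
    simp only [PMF.map_comp]
    cases p using Fin.cases with
    | zero =>
      have h : ∀ m : ℕ, ((fun a : Fin (k + 1) → ℕ => a 0) ∘ Fin.cons m) =
          Function.const (Fin k → ℕ) m := fun m => by ext; simp
      simp only [h, PMF.map_const, PMF.bind_pure]
    | succ p =>
      have h : ∀ m : ℕ, ((fun a : Fin (k + 1) → ℕ => a p.succ) ∘ Fin.cons m) =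
          fun a : Fin k → ℕ => a p := fun m => by ext; simp
      simp only [h, ih fun j => q j.succ, PMF.bind_const]

/-- Shifting an i.i.d. vector up in coordinate `p` and down in coordinate `q`. -/
lemma pmfPi_map_le_of_shift {k : ℕ} {β : Type*} (P : PMF ℕ) {c d : ℝ≥0∞}
    (hup : P.toOuterMeasure {m | ¬ P m ≤ c * P (m + 1)} ≤ d)
    (hdown : P.toOuterMeasure {m | ¬ (1 ≤ m ∧ P m ≤ c * P (m - 1))} ≤ d)
    {p q : Fin k} (hpq : p ≠ q) {u v : Fin k → ℕ}
    (huv : ∀ j, u j + (if q = j then 1 else 0) = v j + (if p = j then 1 else 0))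
    {f f' : (Fin k → ℕ) → β} (hf : Function.Injective f)
    (hff : ∀ a b : Fin k → ℕ, (∀ j, b j + v j = a j + u j) → f' b = f a) (T : Set β) :
    ((pmfPi fun _ => P).map f).toOuterMeasure T ≤
      c ^ 2 * ((pmfPi fun _ => P).map f').toOuterMeasure T + 2 * d := by
  set U : Set ℕ := {m | ¬ P m ≤ c * P (m + 1)} with hU
  set D : Set ℕ := {m | ¬ (1 ≤ m ∧ P m ≤ c * P (m - 1))} with hD
  have hmarg : ∀ (j : Fin k) (S : Set ℕ),
      (pmfPi fun _ : Fin k => P).toOuterMeasure ((fun a => a j) ⁻¹' S) = P.toOuterMeasure S := by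
    intro j S
    rw [← PMF.toOuterMeasure_map_apply, pmfPi_map_eval]
  refine PMF.toOuterMeasure_map_le_of_shift (B := (fun a => a p) ⁻¹' U ∪ (fun a => a q) ⁻¹' D) _ hf
    (fun a j => a j + u j - v j) ?_ ?_ T
  · refine (MeasureTheory.measure_union_le _ _).trans ?_
    rw [hmarg, hmarg, two_mul]
    exact add_le_add hup hdown
  · intro a ha
    simp only [Set.mem_union, Set.mem_preimage, hU, hD, Set.mem_ofPred_eq, not_or, not_not] at ha
    obtain ⟨hp, hq1, hq⟩ := ha
    refine ⟨?_, hff _ _ fun j => ?_⟩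
    · rw [pmfPi_apply, pmfPi_apply]
      calc ∏ j, P (a j)
          ≤ ∏ j, ((if p = j then c else 1) * (if q = j then c else 1)) *
              P (a j + u j - v j) := by
            refine Finset.prod_le_prod' fun j _ => ?_
            have h := huv j
            by_cases h1 : p = j
            · subst h1
              simp only [if_neg hpq.symm, if_true, mul_one] at h ⊢
              rwa [show a p + u p - v p = a p + 1 by omega]
            · by_cases h2 : q = j
              · subst h2
                simp only [if_neg hpq, if_true, one_mul] at h ⊢
                rwa [show a q + u q - v q = a q - 1 by omega]
              · simp only [h1, h2, if_false, one_mul] at h ⊢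
                rw [show a j + u j - v j = a j by omega]
        _ = c ^ 2 * ∏ j, P (a j + u j - v j) := by
            rw [Finset.prod_mul_distrib, Finset.prod_mul_distrib]
            simp [sq]
    · have h := huv j
      have : q = j → 1 ≤ a j := by
        rintro rfl
        exact hq1
      split_ifs at h <;> simp_all <;> omega

lemma binomHalf_apply (l m : ℕ) :
    binomHalf l m = ENNReal.ofReal ((l.choose m : ℝ) / 2 ^ l) := by
  classical
  rw [binomHalf, PMF.map_apply, tsum_fintype]
  by_cases hm : m ≤ l
  · rw [Finset.sum_eq_single (⟨m, Nat.lt_succ_of_le hm⟩ : Fin (l + 1))]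
    · have half : ((1 / 2 : NNReal) : ℝ≥0∞) = ENNReal.ofReal (1 / 2) := by
        simp
      have half' : (1 : ℝ≥0∞) - ENNReal.ofReal (1 / 2) = ENNReal.ofReal (1 / 2) := by
        rw [← ENNReal.ofReal_one, ← ENNReal.ofReal_sub _ (by norm_num)]
        norm_num
      rw [if_pos rfl, PMF.binomial_apply, half, half', ← pow_add, Fin.val_last,
        Nat.add_sub_cancel' hm, ← ENNReal.ofReal_natCast, ← ENNReal.ofReal_pow (by norm_num),
        ← ENNReal.ofReal_mul (by positivity)]
      congr 1
      rw [one_div, inv_pow]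
      ring
    · intro b _ hb
      rw [if_neg]
      rintro rfl
      exact hb rfl
    · simp
  · rw [Nat.choose_eq_zero_of_lt (not_le.mp hm)]
    simp only [Nat.cast_zero, zero_div, ENNReal.ofReal_zero]
    refine Finset.sum_eq_zero fun i _ => if_neg ?_
    have := i.isLt
    omega

/-- Chernoff bound for `Binomial(l, 1/2)`. -/
lemma binomHalf_toOuterMeasure_le (l : ℕ) (u h : ℝ) {S : Set ℕ}
    (hS : ∀ m ∈ S, m ≤ l → h ≤ u * (l - 2 * m)) :
    (binomHalf l).toOuterMeasure S ≤ ENNReal.ofReal (Real.exp (l * (u ^ 2 / 2) - h)) := by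
  have hzero : ∀ m, l < m → binomHalf l m = 0 := by
    intro m hm
    simp [binomHalf_apply, Nat.choose_eq_zero_of_lt hm]
  have hsum : (∑ m ∈ Finset.range (l + 1),
      (l.choose m : ℝ) / 2 ^ l * Real.exp (u * (l - 2 * m) - h)) =
        Real.cosh u ^ l * Real.exp (-h) := by
    rw [Real.cosh_eq, div_pow, add_comm (Real.exp u), add_pow, Finset.sum_div, Finset.sum_mul]
    refine Finset.sum_congr rfl fun m hm => ?_
    have hm' : m ≤ l := Nat.lt_succ_iff.mp (Finset.mem_range.mp hm)
    rw [← Real.exp_nat_mul, ← Real.exp_nat_mul, Nat.cast_sub hm',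
      show u * (l - 2 * m) - h = (m * -u + (l - m) * u) + -h by ring, Real.exp_add, Real.exp_add]
    ring
  rw [PMF.toOuterMeasure_apply, tsum_eq_sum (s := Finset.range (l + 1))]
  · calc ∑ m ∈ Finset.range (l + 1), S.indicator (binomHalf l) m
        ≤ ∑ m ∈ Finset.range (l + 1), ENNReal.ofReal
            ((l.choose m : ℝ) / 2 ^ l * Real.exp (u * (l - 2 * m) - h)) := by
          refine Finset.sum_le_sum fun m hm => ?_
          have hm' : m ≤ l := Nat.lt_succ_iff.mp (Finset.mem_range.mp hm)
          by_cases hmS : m ∈ S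
          · rw [Set.indicator_of_mem hmS, binomHalf_apply]
            refine ENNReal.ofReal_le_ofReal (le_mul_of_one_le_right (by positivity) ?_)
            exact Real.one_le_exp (by linarith [hS m hmS hm'])
          · simp [hmS]
      _ = ENNReal.ofReal (Real.cosh u ^ l * Real.exp (-h)) := by
          rw [← ENNReal.ofReal_sum_of_nonneg fun m _ => by positivity, hsum]
      _ ≤ _ := by
          refine ENNReal.ofReal_le_ofReal ?_
          rw [sub_eq_add_neg, Real.exp_add, Real.exp_nat_mul]
          gcongr
          exact Real.cosh_le_exp_half_sq u
  · intro m hm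
    rw [Set.indicator_apply_eq_zero]
    intro _
    exact hzero m (by simpa using hm)

section Tail

variable {ε δ : ℝ} {l : ℕ}

lemma tail_exponent_le {r : ℝ} (hr0 : 0 < r) (hδ0 : 0 < δ) (hδ1 : δ < 1)
    (hl : 20 * (1 / r) ^ 2 * Real.log (2 / δ) ≤ l) :
    Real.exp (l * (r ^ 2 / 2) - r * (l * r - (1 - r))) ≤ δ := by
  have hL : Real.log 2 ≤ Real.log (2 / δ) :=
    Real.log_le_log (by norm_num) (by rw [le_div_iff₀ hδ0]; linarith)
  have h2 := Real.log_two_gt_d9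
  have hlr : 20 * Real.log (2 / δ) ≤ l * r ^ 2 := by
    calc 20 * Real.log (2 / δ) = 20 * (1 / r) ^ 2 * Real.log (2 / δ) * r ^ 2 := by
          field_simp
      _ ≤ _ := by gcongr
  calc _ ≤ Real.exp (-Real.log (2 / δ)) := by
        apply Real.exp_le_exp.mpr
        nlinarith [sq_nonneg (r - 1 / 2)]
    _ = δ / 2 := by
        rw [Real.exp_neg, Real.exp_log (by positivity), inv_div]
    _ ≤ δ := by linarith

lemma exp_sub_div_exp_add_pos (hε : 0 < ε) : 0 < (Real.exp ε - 1) / (Real.exp ε + 1) := by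
  have := Real.one_lt_exp_iff.mpr hε
  apply div_pos <;> linarith

lemma binomHalf_tail (hε : 0 < ε) (hδ0 : 0 < δ) (hδ1 : δ < 1)
    (hl : 20 * ((Real.exp ε + 1) / (Real.exp ε - 1)) ^ 2 * Real.log (2 / δ) ≤ l) {S : Set ℕ}
    {s : ℝ} (hs : s ^ 2 = 1)
    (hS : ∀ m ∈ S, m ≤ l →
      ((l - s * (l - 2 * m)) / 2) * (Real.exp ε + 1) ≤ l + 1) :
    (binomHalf l).toOuterMeasure S ≤ ENNReal.ofReal δ := by
  set r := (Real.exp ε - 1) / (Real.exp ε + 1) with hr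
  have hr0 : 0 < r := exp_sub_div_exp_add_pos hε
  have he := Real.one_lt_exp_iff.mpr hε
  rw [← one_div_div, ← hr] at hl
  refine (binomHalf_toOuterMeasure_le l (s * r) (r * (l * r - (1 - r))) fun m hm hml => ?_).trans
    (ENNReal.ofReal_le_ofReal ?_)
  · have h := hS m hm hml
    have h1 : 1 - r = 2 / (Real.exp ε + 1) := by
      rw [hr]
      field_simp
      ring
    have h2 : (l - s * (l - 2 * m)) ≤ (l + 1) * (1 - r) := by
      rw [h1, mul_div_assoc', le_div_iff₀ (by linarith)]
      linarith
    calc r * (l * r - (1 - r)) ≤ r * (s * (l - 2 * m)) := by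
          gcongr
          linarith
      _ = _ := by ring
  · rw [mul_pow, hs, one_mul]
    exact tail_exponent_le hr0 hδ0 hδ1 hl

lemma binomHalf_apply_le_succ {m : ℕ} (hm : m ≤ l)
    (h : (l + 1 : ℝ) ≤ (l - m) * (Real.exp ε + 1)) :
    binomHalf l m ≤ ENNReal.ofReal (Real.exp ε) * binomHalf l (m + 1) := by
  rw [binomHalf_apply, binomHalf_apply, ← ENNReal.ofReal_mul (Real.exp_pos ε).le, ← mul_div_assoc]
  refine ENNReal.ofReal_le_ofReal ?_
  gcongr
  have hch : (l.choose (m + 1) : ℝ) * (m + 1) = l.choose m * (l - m) := by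
    rw [← Nat.cast_sub hm]
    exact_mod_cast Nat.choose_succ_right_eq l m
  have hpos : (0 : ℝ) < m + 1 := by positivity
  refine le_of_mul_le_mul_right ?_ hpos
  rw [mul_assoc, hch, mul_left_comm]
  gcongr
  linarith

lemma binomHalf_succ_apply_le {m : ℕ} (hm : m < l)
    (h : (l + 1 : ℝ) ≤ (m + 1) * (Real.exp ε + 1)) :
    binomHalf l (m + 1) ≤ ENNReal.ofReal (Real.exp ε) * binomHalf l m := by
  rw [binomHalf_apply, binomHalf_apply, ← ENNReal.ofReal_mul (Real.exp_pos ε).le, ← mul_div_assoc]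
  refine ENNReal.ofReal_le_ofReal ?_
  gcongr
  have hch : (l.choose (m + 1) : ℝ) * (m + 1) = l.choose m * (l - m) := by
    rw [← Nat.cast_sub hm.le]
    exact_mod_cast Nat.choose_succ_right_eq l m
  have hpos : (0 : ℝ) < m + 1 := by positivity
  refine le_of_mul_le_mul_right ?_ hpos
  rw [hch, mul_comm (Real.exp ε), mul_assoc]
  gcongr
  linarith

lemma binomHalf_shift_up (hε : 0 < ε) (hδ0 : 0 < δ) (hδ1 : δ < 1)
    (hl : 20 * ((Real.exp ε + 1) / (Real.exp ε - 1)) ^ 2 * Real.log (2 / δ) ≤ l) :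
    (binomHalf l).toOuterMeasure
      {m | ¬ binomHalf l m ≤ ENNReal.ofReal (Real.exp ε) * binomHalf l (m + 1)} ≤
        ENNReal.ofReal δ := by
  refine binomHalf_tail hε hδ0 hδ1 hl (s := -1) (by norm_num) fun m hm hml => ?_
  by_contra! hcon
  exact hm (binomHalf_apply_le_succ hml (by linarith))

lemma binomHalf_shift_down (hε : 0 < ε) (hδ0 : 0 < δ) (hδ1 : δ < 1)
    (hl : 20 * ((Real.exp ε + 1) / (Real.exp ε - 1)) ^ 2 * Real.log (2 / δ) ≤ l) :
    (binomHalf l).toOuterMeasure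
      {m | ¬ (1 ≤ m ∧ binomHalf l m ≤ ENNReal.ofReal (Real.exp ε) * binomHalf l (m - 1))} ≤
        ENNReal.ofReal δ := by
  refine binomHalf_tail hε hδ0 hδ1 hl (s := 1) (by norm_num) fun m hm hml => ?_
  by_contra! hcon
  obtain _ | m := m
  · have : (0 : ℝ) ≤ l := l.cast_nonneg
    norm_num at hcon
    linarith
  · refine hm ⟨by omega, binomHalf_succ_apply_le (by omega) ?_⟩
    push_cast at hcon
    linarith

end Tail

section Counts

variable {k n : ℕ} {x x' : Fin n → Fin k} {i : Fin n}

lemma cnt_eq_add_sum (x : Fin n → Fin k) (i : Fin n) (j : Fin k) (t : ℕ) :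
    cnt x j t = (if (i : ℕ) < t ∧ x i = j then 1 else 0) +
      ∑ m ∈ Finset.univ.erase i, if (m : ℕ) < t ∧ x m = j then 1 else 0 := by
  rw [cnt, Finset.card_filter, ← Finset.add_sum_erase _ _ (Finset.mem_univ i)]

lemma sum_erase_eq (h : ∀ j, j ≠ i → x j = x' j) (j : Fin k) (t : ℕ) :
    (∑ m ∈ Finset.univ.erase i, if (m : ℕ) < t ∧ x m = j then 1 else 0) =
      ∑ m ∈ Finset.univ.erase i, if (m : ℕ) < t ∧ x' m = j then 1 else 0 :=
  Finset.sum_congr rfl fun m hm => by rw [h m (Finset.ne_of_mem_erase hm)]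

lemma cnt_eq_of_le (h : ∀ j, j ≠ i → x j = x' j) {t : ℕ} (ht : t ≤ i) (j : Fin k) :
    cnt x j t = cnt x' j t := by
  rw [cnt_eq_add_sum x i, cnt_eq_add_sum x' i, sum_erase_eq h]
  simp [ht.not_gt]

lemma cnt_add_eq_of_lt (h : ∀ j, j ≠ i → x j = x' j) {t : ℕ} (ht : (i : ℕ) < t) (j : Fin k) :
    cnt x j t + (if x' i = j then 1 else 0) = cnt x' j t + (if x i = j then 1 else 0) := by
  rw [cnt_eq_add_sum x i, cnt_eq_add_sum x' i, sum_erase_eq h]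
  simp only [ht, true_and]
  ring

end Counts

lemma histJoint_eq_bind_map (lam k n : ℕ) (x : Fin n → Fin k) (t : ℕ) :
    histJoint lam k n x t = (pmfPi fun _ => binomHalf lam).bind fun b =>
      (pmfPi fun _ => binomHalf lam).map fun a =>
        (fun j => a j + cnt x j t, fun j => a j + cnt x j n + b j) :=
  PMF.bind_map_comm _ _ _

lemma le_of_mem_support_pmfPi_binomHalf {k l : ℕ} {a : Fin k → ℕ}
    (ha : a ∈ (pmfPi fun _ => binomHalf l).support) (j : Fin k) : a j ≤ l := by
  rw [PMF.mem_support_iff, pmfPi_apply, Finset.prod_ne_zero_iff] at ha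
  by_contra! hj
  exact ha j (Finset.mem_univ j) (by simp [binomHalf_apply, Nat.choose_eq_zero_of_lt hj])

/-- For `ε > 0`, `δ ∈ (0,1)`, `k ≥ 1`, and
`λ ≥ 20·((e^ε+1)/(e^ε-1))²·ln(2/δ)`, the pan-private histogram algorithm is
`(2ε, 2δ)`-pan-private, and on every stream its output surely has `ℓ∞` error
at most `2λ`: `|c̃_j - c_j(x)| ≤ 2λ` for all `j`. -/
theorem stmt_12
    (ε δ : ℝ) (hε : 0 < ε) (hδ0 : 0 < δ) (hδ1 : δ < 1)
    (k : ℕ) (hk : 1 ≤ k) (lam : ℕ)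
    (hlam : 20 * ((Real.exp ε + 1) / (Real.exp ε - 1)) ^ 2 * Real.log (2 / δ)
      ≤ (lam : ℝ))
    (n : ℕ) :
    -- pan-privacy with parameters (2ε, 2δ)
    (∀ x x' : Fin n → Fin k, Neighbor x x' → ∀ t ≤ n,
      ∀ T : Set ((Fin k → ℕ) × (Fin k → ℕ)),
        (histJoint lam k n x t).toOuterMeasure T ≤
          ENNReal.ofReal (Real.exp (2 * ε)) *
            (histJoint lam k n x' t).toOuterMeasure T +
          ENNReal.ofReal (2 * δ)) ∧
    -- accuracy: surely max_j |c̃_j − c_j(x)| ≤ 2λ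
    (∀ x : Fin n → Fin k,
      ((histJoint lam k n x 0).map Prod.snd).toOuterMeasure
        {c | ∀ j, |(c j : ℝ) - (cnt x j n : ℝ)| ≤ 2 * lam} = 1) := by
  constructor
  · rintro x x' ⟨i, hi⟩ t ht T
    have hc : ENNReal.ofReal (Real.exp (2 * ε)) = ENNReal.ofReal (Real.exp ε) ^ 2 := by
      rw [← ENNReal.ofReal_pow (Real.exp_pos ε).le, ← Real.exp_nat_mul]
      norm_num
    have hd : ENNReal.ofReal (2 * δ) = 2 * ENNReal.ofReal δ := by
      rw [ENNReal.ofReal_mul (by norm_num)]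
      norm_num
    by_cases hpq : x i = x' i
    · have hxx : x = x' := by
        ext1 j
        by_cases hj : j = i
        · rw [hj, hpq]
        · exact hi j hj
      subst hxx
      refine le_add_right (le_mul_of_one_le_left zero_le ?_)
      rw [ENNReal.one_le_ofReal]
      exact Real.one_le_exp (by linarith)
    have hup := binomHalf_shift_up hε hδ0 hδ1 hlam
    have hdown := binomHalf_shift_down hε hδ0 hδ1 hlam
    have hn := cnt_add_eq_of_lt hi i.isLt
    rw [hc, hd]
    by_cases hit : (i : ℕ) < t
    · have hti := cnt_add_eq_of_lt hi hit
      rw [histJoint_eq_bind_map, histJoint_eq_bind_map]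
      refine PMF.toOuterMeasure_bind_le _ fun b =>
        pmfPi_map_le_of_shift _ hup hdown hpq hn ?_ ?_ T
      · intro a a' haa
        ext j
        exact Nat.add_right_cancel (congrFun (congrArg Prod.fst haa) j)
      · intro a a' haa
        ext j <;> have h1 := haa j <;> have h2 := hn j <;> have h3 := hti j <;> dsimp only <;> omega
    · have hti := cnt_eq_of_le hi (not_lt.mp hit)
      refine PMF.toOuterMeasure_bind_le _ fun a =>
        pmfPi_map_le_of_shift _ hup hdown hpq hn ?_ ?_ T
      · intro b b' hbb
        ext j
        exact Nat.add_left_cancel (congrFun (congrArg Prod.snd hbb) j)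
      · intro b b' hbb
        ext j <;> have h1 := hbb j <;> have h3 := hti j <;> dsimp only <;> omega
  · intro x
    rw [PMF.toOuterMeasure_apply_eq_one_iff]
    intro c hc
    simp only [histJoint, PMF.support_map, PMF.support_bind, Set.mem_image, Set.mem_iUnion] at hc
    obtain ⟨_, ⟨a, ha, b, hb, rfl⟩, rfl⟩ := hc
    intro j
    have h1 : (a j : ℝ) ≤ lam := by exact_mod_cast le_of_mem_support_pmfPi_binomHalf ha j
    have h2 : (b j : ℝ) ≤ lam := by exact_mod_cast le_of_mem_support_pmfPi_binomHalf hb j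
    have h3 : (0 : ℝ) ≤ a j := by positivity
    have h4 : (0 : ℝ) ≤ b j := by positivity
    push_cast
    rw [abs_le]
    constructor <;> linarith
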